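/- arXiv:1701.05888 — 3 statements merged into one kernel-verified Lean document; each statement's English description precedes it below -/
import Mathlib

section
/- Let X be a finite nonempty type and let Q : ℕ → X → Prop be a step-indexed predicate, i.e. Q is downward closed in the step index (if Q n x holds and m ≤ n, then Q m x). If for every natural number n there exists some x ∈ X such that Q n x holds, then there exists a single x ∈ X such that Q n x holds for every natural number n. -/
theorem stmt_0 {X : Type*} [Finite X] [Nonempty X] (Q : ℕ → X → Prop)
    (hdown : ∀ n m x, Q n x → m ≤ n → Q m x)
    (h : ∀ n, ∃ x, Q n x) :
    ∃ x, ∀ n, Q n x := by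
  by_contra! hne
  choose f hf using hne
  obtain ⟨N, hN⟩ := Finite.exists_le f
  obtain ⟨x, hx⟩ := h N
  exact hf x (hdown N (f x) x hx (hN x))
end

section
/- Let α be a type, let R : α → α → Prop be a relation that is finitely branching (for every s, the set {s' | R s s'} of R-successors of s is finite), and let Q : ℕ → α → Prop be downward closed in the step index (if Q n x holds and m ≤ n, then Q m x). Suppose that for every s satisfying Q n s for all n, and for every natural number n, there exists s' with R s s' and Q n s'. Then for every s₀ satisfying Q n s₀ for all n, there exists an infinite sequence f : ℕ → α with f 0 = s₀ such that R (f k) (f (k+1)) holds for every k, and Q n (f k) holds for every n and every k. -/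
/-- Quantifier inversion: if a finite set contains, for each step index, a point satisfying a
downward closed predicate at that index, then one of its points satisfies it at all indices. -/
theorem Set.Finite.exists_forall_of_forall_exists {α : Type*} {S : Set α} (hS : S.Finite)
    {Q : ℕ → α → Prop} (hdown : ∀ n m x, Q n x → m ≤ n → Q m x)
    (h : ∀ n, ∃ x ∈ S, Q n x) : ∃ x ∈ S, ∀ n, Q n x := by
  by_contra! hcon
  choose! N hN using hcon
  obtain ⟨b, hb⟩ := (hS.image N).bddAbove
  obtain ⟨x, hxS, hx⟩ := h b
  exact hN x hxS (hdown b (N x) x hx (hb (Set.mem_image_of_mem N hxS)))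

theorem stmt_4 {α : Type*} (R : α → α → Prop)
    (hfin : ∀ s, {s' | R s s'}.Finite)
    (Q : ℕ → α → Prop)
    (hdown : ∀ n m x, Q n x → m ≤ n → Q m x)
    (hstep : ∀ s, (∀ n, Q n s) → ∀ n, ∃ s', R s s' ∧ Q n s')
    (s₀ : α) (h₀ : ∀ n, Q n s₀) :
    ∃ f : ℕ → α, f 0 = s₀ ∧ (∀ k, R (f k) (f (k + 1))) ∧ ∀ n k, Q n (f k) := by
  have hnext : ∀ s : {s // ∀ n, Q n s}, ∃ s' : {s // ∀ n, Q n s}, R s s' := fun s ↦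
    let ⟨s', hR, hQ⟩ :=
      (hfin s).exists_forall_of_forall_exists hdown (hstep s s.2)
    ⟨⟨s', hQ⟩, hR⟩
  choose next hnext using hnext
  refine ⟨fun k ↦ (next^[k] ⟨s₀, h₀⟩ : {s // ∀ n, Q n s}), rfl, fun k ↦ ?_, fun n k ↦ ?_⟩
  · simpa only [Function.iterate_succ_apply'] using hnext (next^[k] ⟨s₀, h₀⟩)
  · exact (next^[k] ⟨s₀, h₀⟩).2 n
end

section
/- Let T and S be types, let →ₜ : T → T → Prop be any relation, and let →ₛ : S → S → Prop be a finitely branching relation (for every s, the set {s' | s →ₛ s'} is finite). Let Q : ℕ → T → S → Prop be downward closed in the step index (if Q n t s holds and m ≤ n, then Q m t s) and satisfy the one-step simulation property: for all n, t, t', s, if t →ₜ t' and Q (n+1) t s hold, then there exists s' with s →ₛ s' and Q n t' s'. Suppose t₀ : T and s₀ : S satisfy Q n t₀ s₀ for every n, and suppose there is an infinite execution of the target from t₀, i.e. a sequence t : ℕ → T with t 0 = t₀ and t k →ₜ t (k+1) for every k. Then there is an infinite execution of the source from s₀, i.e. a sequence s : ℕ → S with s 0 = s₀ and s k →ₛ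 s (k+1) for every k; moreover this sequence can be chosen so that for every k and every n, Q n (t k) (s k) holds. -/
/-- Quantifier inversion: if an antitone family of predicates on a finite set has a witness at
every index, then some element is a witness at all indices. -/
theorem Set.Finite.exists_mem_forall_of_forall_exists_mem {α : Type*} {A : Set α} (hA : A.Finite)
    {P : ℕ → α → Prop} (hdown : ∀ n m a, P n a → m ≤ n → P m a)
    (h : ∀ n, ∃ a ∈ A, P n a) : ∃ a ∈ A, ∀ n, P n a := by
  by_contra! hcon
  choose! f hf using hcon
  obtain ⟨N, hN⟩ := (hA.image f).bddAbove
  obtain ⟨a, ha, hPa⟩ := h N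
  exact hf a ha (hdown N _ a hPa (hN (Set.mem_image_of_mem f ha)))

theorem stmt_5 {T S : Type*}
    (stepT : T → T → Prop) (stepS : S → S → Prop)
    (hfin : ∀ s, {s' | stepS s s'}.Finite)
    (Q : ℕ → T → S → Prop)
    (hdown : ∀ n m t s, Q n t s → m ≤ n → Q m t s)
    (hsim : ∀ n t t' s, stepT t t' → Q (n + 1) t s → ∃ s', stepS s s' ∧ Q n t' s')
    (t₀ : T) (s₀ : S) (h₀ : ∀ n, Q n t₀ s₀)
    (t : ℕ → T) (ht0 : t 0 = t₀) (htstep : ∀ k, stepT (t k) (t (k + 1))) :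
    ∃ s : ℕ → S, s 0 = s₀ ∧ (∀ k, stepS (s k) (s (k + 1))) ∧
      ∀ k n, Q n (t k) (s k) := by
  have hnext : ∀ k s, (∀ n, Q n (t k) s) → ∃ s', stepS s s' ∧ ∀ n, Q n (t (k + 1)) s' :=
    fun k s hs => (hfin s).exists_mem_forall_of_forall_exists_mem
      (fun n m => hdown n m (t (k + 1)))
      fun n => hsim n (t k) (t (k + 1)) s (htstep k) (hs (n + 1))
  have : Nonempty S := ⟨s₀⟩
  choose! next hstep hQ using hnext
  let s : ℕ → S := fun k => Nat.rec s₀ next k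
  have hs : ∀ k n, Q n (t k) (s k) := by
    intro k
    induction k with
    | zero => exact ht0 ▸ h₀
    | succ k ih => exact hQ k (s k) ih
  exact ⟨s, rfl, fun k => hstep k (s k) (hs k), hs⟩
end
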